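/- Consider M jointly realizable linear regression tasks with data radius R > 0, and let w⋆ satisfy X_m w⋆ = y_m for all m. Let k ≥ 2, use the increasing regularization schedule λ_t = (13R²/3)·(k+1)/(k−t+2) for t = 1,…,k, let τ be a random with-replacement ordering of length k, and let w_0, w_1, …, w_k be the regularized continual linear regression iterates started from an arbitrary w_0 ∈ ℝ^d. Then the expected average loss satisfies E_τ L(w_k) ≤ 20·‖w_0 − w⋆‖²·R²/(k+1). -/

import Mathlib

open Matrix

/-- Matrix-vector multiplication viewed as a map between Euclidean spaces. -/
noncomputable def mulVecE {n d : ℕ} (X : Matrix (Fin n) (Fin d) ℝ)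
    (v : EuclideanSpace ℝ (Fin d)) : EuclideanSpace ℝ (Fin n) :=
  (WithLp.equiv 2 (Fin n → ℝ)).symm (X.mulVec (WithLp.equiv 2 (Fin d → ℝ) v))

lemma mulVecE_eq {n d : ℕ} (X : Matrix (Fin n) (Fin d) ℝ) (v : EuclideanSpace ℝ (Fin d)) :
    mulVecE X v = Matrix.toEuclideanLin X v := rfl

lemma mulVecE_add' {n d : ℕ} (X : Matrix (Fin n) (Fin d) ℝ) (v w : EuclideanSpace ℝ (Fin d)) :
    mulVecE X (v + w) = mulVecE X v + mulVecE X w := by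
  simp only [mulVecE_eq, map_add]

lemma mulVecE_sub' {n d : ℕ} (X : Matrix (Fin n) (Fin d) ℝ) (v w : EuclideanSpace ℝ (Fin d)) :
    mulVecE X (v - w) = mulVecE X v - mulVecE X w := by
  simp only [mulVecE_eq, map_sub]

lemma mulVecE_smul' {n d : ℕ} (X : Matrix (Fin n) (Fin d) ℝ) (c : ℝ)
    (v : EuclideanSpace ℝ (Fin d)) :
    mulVecE X (c • v) = c • mulVecE X v := by
  simp only [mulVecE_eq, map_smul]

lemma mulVecE_mul' {n d e : ℕ} (X : Matrix (Fin n) (Fin d) ℝ) (Y : Matrix (Fin d) (Fin e) ℝ)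
    (v : EuclideanSpace ℝ (Fin e)) :
    mulVecE (X * Y) v = mulVecE X (mulVecE Y v) := by
  ext i
  simp [mulVecE, Matrix.mulVec_mulVec]

lemma mulVecE_adj {n d : ℕ} (X : Matrix (Fin n) (Fin d) ℝ) (p : EuclideanSpace ℝ (Fin n))
    (v : EuclideanSpace ℝ (Fin d)) :
    inner ℝ (mulVecE Xᵀ p) v = inner ℝ p (mulVecE X v) := by
  have h := Matrix.toEuclideanLin_conjTranspose_eq_adjoint X
  rw [Matrix.conjTranspose_eq_transpose_of_trivial] at h
  rw [mulVecE_eq, mulVecE_eq, h, LinearMap.adjoint_inner_left]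

lemma step_exists {n d : ℕ} (X : Matrix (Fin n) (Fin d) ℝ) (y : EuclideanSpace ℝ (Fin n))
    (ws w : EuclideanSpace ℝ (Fin d)) (hy : mulVecE X ws = y) (l : ℝ) (hl : 0 < l)
    (u : EuclideanSpace ℝ (Fin d))
    (hu : u = mulVecE (Xᵀ * X + l • (1 : Matrix (Fin d) (Fin d) ℝ))⁻¹
      (mulVecE Xᵀ y + l • w)) :
    w - ws = (u - ws) + l⁻¹ • mulVecE Xᵀ (mulVecE X (u - ws)) := by
  have hpd : (Xᵀ * X + l • (1 : Matrix (Fin d) (Fin d) ℝ)).PosDef := by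
    apply Matrix.PosDef.posSemidef_add
    · have := Matrix.posSemidef_conjTranspose_mul_self X
      rwa [Matrix.conjTranspose_eq_transpose_of_trivial] at this
    · exact Matrix.PosDef.one.smul hl
  have hdet := (Matrix.isUnit_iff_isUnit_det _).1 hpd.isUnit
  have h1 : mulVecE (Xᵀ * X + l • (1 : Matrix (Fin d) (Fin d) ℝ)) u
      = mulVecE Xᵀ y + l • w := by
    rw [hu, ← mulVecE_mul', Matrix.mul_nonsing_inv _ hdet]
    ext i
    simp [mulVecE]
  have h2 : mulVecE (Xᵀ * X + l • (1 : Matrix (Fin d) (Fin d) ℝ)) u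
      = mulVecE Xᵀ (mulVecE X u) + l • u := by
    rw [← mulVecE_mul']
    ext i
    simp [mulVecE, Matrix.add_mulVec, Matrix.smul_mulVec]
  rw [h2, ← hy] at h1
  have h3 : w = u + l⁻¹ • (mulVecE Xᵀ (mulVecE X u) - mulVecE Xᵀ (mulVecE X ws)) := by
    have : l • w = mulVecE Xᵀ (mulVecE X u) + l • u - mulVecE Xᵀ (mulVecE X ws) := by
      rw [h1]; abel
    have h4 : w = l⁻¹ • (l • w) := by rw [smul_smul, inv_mul_cancel₀ hl.ne', one_smul]
    rw [h4, this, smul_sub, smul_add, smul_smul, inv_mul_cancel₀ hl.ne', one_smul, smul_sub]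
    abel
  rw [mulVecE_sub', mulVecE_sub']
  nth_rewrite 1 [h3]
  abel

lemma step_ineq {n d : ℕ} (X : Matrix (Fin n) (Fin d) ℝ) (R : ℝ) (hR : 0 < R)
    (hX : ∀ v, ‖mulVecE X v‖ ≤ R * ‖v‖) (η v : ℝ) (hη : 0 ≤ η) (hv : 0 ≤ v)
    (u : EuclideanSpace ℝ (Fin d)) (N : ℕ) (q : ℕ → ℝ) (δ : ℕ → EuclideanSpace ℝ (Fin d))
    (hq : ∀ s, s ∈ Finset.range N → 0 ≤ q s) (hqv : ∑ s ∈ Finset.range N, q s ≤ v)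
    (δt : EuclideanSpace ℝ (Fin d)) (hu : δt = u + η • mulVecE Xᵀ (mulVecE X u)) :
    ‖v • u - ∑ s ∈ Finset.range N, q s • δ s‖ ^ 2 ≤
      ‖v • δt - ∑ s ∈ Finset.range N, q s • δ s‖ ^ 2
        - η * v ^ 2 / (1 + η * R ^ 2) ^ 2 * ‖mulVecE X δt‖ ^ 2
        + η * v * ∑ s ∈ Finset.range N, q s * ‖mulVecE X (δ s)‖ ^ 2 := by
  set Z := ∑ s ∈ Finset.range N, q s • δ s with hZ
  set g := mulVecE Xᵀ (mulVecE X u) with hg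
  have hadj : ∀ x, inner ℝ g x = inner ℝ (mulVecE X u) (mulVecE X x) := fun x =>
    mulVecE_adj X _ x
  -- lower bound for the image of u
  have hT : ‖mulVecE Xᵀ (mulVecE X u)‖ ≤ R * ‖mulVecE X u‖ := by
    have h1 : ‖g‖ ^ 2 ≤ ‖mulVecE X u‖ * (R * ‖g‖) := by
      rw [← real_inner_self_eq_norm_sq, hadj]
      exact (real_inner_le_norm _ _).trans
        (mul_le_mul_of_nonneg_left (hX g) (norm_nonneg _))
    by_contra hcon
    push Not at hcon
    have h0 : 0 ≤ R * ‖mulVecE X u‖ := by positivity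
    have : 0 < ‖g‖ := lt_of_le_of_lt h0 hcon
    nlinarith
  have hXδ : ‖mulVecE X δt‖ ≤ (1 + η * R ^ 2) * ‖mulVecE X u‖ := by
    rw [hu, mulVecE_add', mulVecE_smul']
    calc _ ≤ ‖mulVecE X u‖ + ‖η • mulVecE X g‖ := norm_add_le _ _
      _ = ‖mulVecE X u‖ + η * ‖mulVecE X g‖ := by
        rw [norm_smul, Real.norm_of_nonneg hη]
      _ ≤ ‖mulVecE X u‖ + η * (R * (R * ‖mulVecE X u‖)) := by
        gcongr
        exact (hX g).trans (mul_le_mul_of_nonneg_left hT hR.le)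
      _ = _ := by ring
  have hA : η * v ^ 2 / (1 + η * R ^ 2) ^ 2 * ‖mulVecE X δt‖ ^ 2
      ≤ η * v ^ 2 * ‖mulVecE X u‖ ^ 2 := by
    have hpos : 0 < (1 + η * R ^ 2) ^ 2 := by positivity
    rw [div_mul_eq_mul_div, div_le_iff₀ hpos, mul_assoc, mul_assoc]
    rw [mul_assoc]
    refine mul_le_mul_of_nonneg_left (mul_le_mul_of_nonneg_left ?_ (by positivity)) hη
    calc ‖mulVecE X δt‖ ^ 2 ≤ ((1 + η * R ^ 2) * ‖mulVecE X u‖) ^ 2 := by gcongr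
      _ = _ := by ring
  -- cross terms
  have hgZ : 2 * inner ℝ g Z ≤ v * ‖mulVecE X u‖ ^ 2
      + ∑ s ∈ Finset.range N, q s * ‖mulVecE X (δ s)‖ ^ 2 := by
    rw [hZ, inner_sum, Finset.mul_sum]
    calc _ ≤ ∑ s ∈ Finset.range N, (q s * ‖mulVecE X u‖ ^ 2 + q s * ‖mulVecE X (δ s)‖ ^ 2) := by
          apply Finset.sum_le_sum
          intro s hs
          rw [inner_smul_right, hadj]
          have h1 := hq s hs
          have h2 := real_inner_le_norm (mulVecE X u) (mulVecE X (δ s))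
          have h3 := sq_nonneg (‖mulVecE X u‖ - ‖mulVecE X (δ s)‖)
          have h4 : 2 * inner ℝ (mulVecE X u) (mulVecE X (δ s))
            ≤ ‖mulVecE X u‖ ^ 2 + ‖mulVecE X (δ s)‖ ^ 2 := by nlinarith
          nlinarith [mul_le_mul_of_nonneg_left h4 h1]
      _ = (∑ s ∈ Finset.range N, q s) * ‖mulVecE X u‖ ^ 2
          + ∑ s ∈ Finset.range N, q s * ‖mulVecE X (δ s)‖ ^ 2 := by
          rw [Finset.sum_add_distrib, Finset.sum_mul]
      _ ≤ _ := by gcongr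
  have hvu : v • u - Z = (v • δt - Z) - (v * η) • g := by
    rw [hu, smul_add, smul_smul]; abel
  have hgu : inner ℝ g u = ‖mulVecE X u‖ ^ 2 := by
    rw [hadj, real_inner_self_eq_norm_sq]
  have hexp : ‖v • δt - Z‖ ^ 2 = ‖v • u - Z‖ ^ 2
      + 2 * (v * η) * (v * ‖mulVecE X u‖ ^ 2 - inner ℝ g Z) + (v * η) ^ 2 * ‖g‖ ^ 2 := by
    have : v • δt - Z = (v • u - Z) + (v * η) • g := by rw [hvu]; abel
    rw [this, norm_add_sq_real, norm_smul, inner_smul_right, inner_sub_left, inner_smul_left,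
      real_inner_comm g u, hgu, real_inner_comm g Z, mul_pow, Real.norm_eq_abs, sq_abs]
    simp only [conj_trivial]
    ring
  rw [hexp]
  have hvη : 0 ≤ v * η := by positivity
  have h5 := mul_le_mul_of_nonneg_left hgZ hvη
  have h6 : 0 ≤ (v * η) ^ 2 * ‖g‖ ^ 2 := by positivity
  nlinarith

lemma sum_swap {k M : ℕ} (t : Fin k) (g : (Fin k → Fin M) → Fin M → ℝ) (hM : 0 < M)
    (hg : ∀ τ m m', g (Function.update τ t m') m = g τ m) :
    ∑ τ, g τ (τ t) = ∑ τ, (1 / (M : ℝ)) * ∑ m, g τ m := by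
  have h1 : ∑ τ : Fin k → Fin M, ∑ m, g τ m = ∑ τ : Fin k → Fin M, ∑ _m : Fin M, g τ (τ t) := by
    rw [← Fintype.sum_prod_type', ← Fintype.sum_prod_type']
    let e : (Fin k → Fin M) × Fin M → (Fin k → Fin M) × Fin M :=
      fun p => (Function.update p.1 t p.2, p.1 t)
    have he : Function.Involutive e := by
      rintro ⟨τ, m⟩
      simp [e]
    apply Fintype.sum_equiv he.toPerm
    rintro ⟨τ, m⟩
    simp [e, hg]
  rw [← Finset.mul_sum, h1]
  simp only [Finset.sum_const, Finset.card_univ, Fintype.card_fin, nsmul_eq_mul]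
  rw [← Finset.mul_sum]
  have : (M : ℝ) ≠ 0 := by positivity
  field_simp

/-- numeric condition -/
lemma numeric_a (x N : ℝ) (hx : 1 ≤ x) (hN : x ≤ N) :
    (1 + x / (4 * N)) ≤ (1 + x / (2 * N)) ^ 2 / (1 + 3 * x / (13 * N)) ^ 2 := by
  have hN0 : 0 < N := by linarith
  obtain ⟨r, hr⟩ : ∃ r, r = x / N := ⟨_, rfl⟩
  have hr0 : 0 ≤ r := by rw [hr]; positivity
  have hr1 : r ≤ 1 := by rw [hr, div_le_one hN0]; exact hN
  have e1 : x / (4 * N) = r / 4 := by rw [hr]; field_simp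
  have e2 : x / (2 * N) = r / 2 := by rw [hr]; field_simp
  have e3 : 3 * x / (13 * N) = 3 * r / 13 := by rw [hr]; field_simp
  rw [e1, e2, e3, le_div_iff₀ (by positivity)]
  nlinarith [mul_nonneg hr0 hr0, mul_nonneg hr0 (sub_nonneg.2 hr1),
    mul_nonneg (mul_nonneg hr0 hr0) (sub_nonneg.2 hr1)]

lemma numeric_b (x N e : ℝ) (hx : 1 ≤ x) (hN : x ≤ N) (he : 0 ≤ e) :
    e * (x + x * (x + 1) / (4 * N)) * (1 / x - 1 / (x + 1)) ≤
      e * x * (1 / x + 1 / (2 * N)) ^ 2 / (1 + 3 * x / (13 * N)) ^ 2 := by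
  have hN0 : 0 < N := by linarith
  have hx0 : 0 < x := by linarith
  have h := numeric_a x N hx hN
  have e1 : e * x * (1 / x + 1 / (2 * N)) ^ 2 / (1 + 3 * x / (13 * N)) ^ 2
      = e / x * ((1 + x / (2 * N)) ^ 2 / (1 + 3 * x / (13 * N)) ^ 2) := by
    rw [← mul_div_assoc]; congr 1; field_simp
  have e2 : e * (x + x * (x + 1) / (4 * N)) * (1 / x - 1 / (x + 1))
      = e / x * (x / (x + 1) + x / (4 * N)) := by
    field_simp; ring
  rw [e1, e2]
  apply mul_le_mul_of_nonneg_left _ (by positivity)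
  have : x / (x + 1) ≤ 1 := by rw [div_le_one (by positivity)]; linarith
  linarith

lemma numeric_c (N e : ℝ) (hN : 3 ≤ N) (he : 0 ≤ e) :
    e * (5 / 12) ≤ e * 1 * (1 / 1 + 1 / (2 * N)) ^ 2 / (1 + 3 * 1 / (13 * N)) ^ 2
      - e * (1 + 1 * (1 + 1) / (4 * N)) * (1 / 1 - 1 / (1 + 1)) := by
  have h := numeric_a 1 N le_rfl (by linarith)
  have h2 : 1 / N ≤ 1 / 3 := one_div_le_one_div_of_le (by norm_num) hN
  have hN0 : 0 < N := by linarith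
  have h3 : (1 : ℝ) * (1 + 1) / (4 * N) = 1 / N / 2 := by field_simp; norm_num
  have h4 : 0 ≤ 1 / (4 * N) := by positivity
  have e1 : e * 1 * (1 / 1 + 1 / (2 * N)) ^ 2 / (1 + 3 * 1 / (13 * N)) ^ 2
    = e * ((1 + 1 / (2 * N)) ^ 2 / (1 + 3 * 1 / (13 * N)) ^ 2) := by
    rw [← mul_div_assoc]; norm_num
  rw [e1, h3, mul_assoc, ← mul_sub]
  apply mul_le_mul_of_nonneg_left _ he
  linarith

/-- for `M` jointly realizable tasks with data radius `R` and `k ≥ 2`,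
regularized continual linear regression with the increasing schedule
`λ_t = (13R²/3)(k+1)/(k−t+2)` (for `t = 1,…,k`; below `t` is 0-indexed, so the step
from `w_t` to `w_{t+1}` uses `λ_{t+1} = (13R²/3)(k+1)/(k−t+1)`) under a random
with-replacement ordering satisfies `E_τ L(w_k) ≤ 20‖w₀−w⋆‖²R²/(k+1)`. -/
theorem optimal_increasing_regularization {d M : ℕ} (hM : 0 < M)
    (nrows : Fin M → ℕ)
    (X : ∀ m : Fin M, Matrix (Fin (nrows m)) (Fin d) ℝ)
    (y : ∀ m : Fin M, EuclideanSpace ℝ (Fin (nrows m)))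
    (R : ℝ) (hR : 0 < R)
    (hX : ∀ (m : Fin M) (v : EuclideanSpace ℝ (Fin d)), ‖mulVecE (X m) v‖ ≤ R * ‖v‖)
    (wstar : EuclideanSpace ℝ (Fin d)) (hreal : ∀ m, mulVecE (X m) wstar = y m)
    (k : ℕ) (hk : 2 ≤ k)
    (lam : Fin k → ℝ)
    (hlam : ∀ t : Fin k,
      lam t = (13 * R ^ 2 / 3) * (((k : ℝ) + 1) / ((k : ℝ) - (t.1 : ℝ) + 1)))
    (w0 : EuclideanSpace ℝ (Fin d))
    (w : (Fin k → Fin M) → ℕ → EuclideanSpace ℝ (Fin d))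
    (hw0 : ∀ τ, w τ 0 = w0)
    (hwt : ∀ (τ : Fin k → Fin M) (t : Fin k),
      w τ (t.1 + 1) =
        mulVecE ((X (τ t))ᵀ * X (τ t) + lam t • (1 : Matrix (Fin d) (Fin d) ℝ))⁻¹
          (mulVecE (X (τ t))ᵀ (y (τ t)) + lam t • w τ t.1)) :
    (∑ τ : Fin k → Fin M, (1 / (M : ℝ)) * ∑ m, (1 / 2) * ‖mulVecE (X m) (w τ k) - y m‖ ^ 2)
        / (M : ℝ) ^ k
      ≤ 20 * ‖w0 - wstar‖ ^ 2 * R ^ 2 / ((k : ℝ) + 1) := by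
  have hk3 : (3 : ℝ) ≤ (k : ℝ) + 1 := by
    have : (2 : ℝ) ≤ k := by exact_mod_cast hk
    linarith
  have hMr : (0 : ℝ) < M := by exact_mod_cast hM
  obtain ⟨e, he⟩ : ∃ e : ℝ, e = 3 / (13 * R ^ 2 * ((k : ℝ) + 1)) := ⟨_, rfl⟩
  have he0 : 0 < e := by rw [he]; positivity
  have heR : e * R ^ 2 = 3 / (13 * ((k : ℝ) + 1)) := by rw [he]; field_simp
  obtain ⟨V, hV⟩ : ∃ V : ℕ → ℝ, ∀ t, V t = 1 / ((k : ℝ) - t + 2) + 1 / (2 * ((k : ℝ) + 1)) :=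
    ⟨_, fun _ => rfl⟩
  have hV1 : ∀ t, V (t + 1) = 1 / ((k : ℝ) - t + 1) + 1 / (2 * ((k : ℝ) + 1)) := by
    intro t
    rw [hV]
    push_cast
    congr 2
    ring
  obtain ⟨q, hq⟩ : ∃ q : ℕ → ℝ, ∀ s, q s = V (s + 1) - V s := ⟨_, fun _ => rfl⟩
  obtain ⟨η, hη⟩ : ∃ η : ℕ → ℝ, ∀ t, η t = e * ((k : ℝ) - t + 1) := ⟨_, fun _ => rfl⟩
  obtain ⟨δ, hδ⟩ : ∃ δ : (Fin k → Fin M) → ℕ → EuclideanSpace ℝ (Fin d),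
    ∀ τ t, δ τ t = w τ t - wstar := ⟨_, fun _ _ => rfl⟩
  have hx1 : ∀ t : ℕ, t ≤ k → (1 : ℝ) ≤ (k : ℝ) - t + 1 := by
    intro t ht
    have : (t : ℝ) ≤ k := by exact_mod_cast ht
    linarith
  have hη0 : ∀ t, t ≤ k → 0 < η t := by
    intro t ht
    have := hx1 t ht
    rw [hη]
    exact mul_pos he0 (by linarith)
  have hVpos : ∀ t, t ≤ k + 1 → 0 < V t := by
    intro t ht
    have h1 : (t : ℝ) ≤ k + 1 := by exact_mod_cast ht
    have h2 : (0 : ℝ) < (k : ℝ) - t + 2 := by linarith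
    rw [hV]
    positivity
  have hqx : ∀ s, q s = 1 / ((k : ℝ) - s + 1) - 1 / (((k : ℝ) - s + 1) + 1) := by
    intro s
    rw [hq, hV1, hV]
    have : (k : ℝ) - s + 1 + 1 = (k : ℝ) - s + 2 := by ring
    rw [this]
    ring
  have hq0 : ∀ s, s ≤ k → 0 ≤ q s := by
    intro s hs
    have h1 := hx1 s hs
    rw [hqx, sub_nonneg]
    exact one_div_le_one_div_of_le (by linarith) (by linarith)
  have hqsum : ∀ t, t ≤ k → ∑ s ∈ Finset.range (t + 1), q s ≤ V (t + 1) := by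
    intro t ht
    simp only [hq]
    rw [Finset.sum_range_sub]
    have := hVpos 0 (by omega)
    linarith
  have hqmem : ∀ t, t ≤ k → ∀ s ∈ Finset.range (t + 1), 0 ≤ q s := by
    intro t ht s hs
    have := Finset.mem_range.1 hs
    exact hq0 s (by omega)
  -- dependence on the past only
  have hdep : ∀ t, t ≤ k → ∀ τ τ' : Fin k → Fin M, (∀ i : Fin k, i.1 < t → τ i = τ' i) →
      w τ t = w τ' t := by
    intro t
    induction t with
    | zero => intro _ τ τ' _; rw [hw0, hw0]
    | succ t ih =>
      intro ht τ τ' hag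
      have h1 := hwt τ ⟨t, by omega⟩
      have h2 := hwt τ' ⟨t, by omega⟩
      have h3 := ih (by omega) τ τ' (fun i hi => hag i (by omega))
      have h4 := hag ⟨t, by omega⟩ (by simp)
      simp only at h1 h2
      rw [h1, h2, h3, h4]
  obtain ⟨U, hU⟩ : ∃ U : (Fin k → Fin M) → ℕ → EuclideanSpace ℝ (Fin d),
    ∀ τ t, U τ t = V t • δ τ t - ∑ s ∈ Finset.range t, q s • δ τ s := ⟨_, fun _ _ => rfl⟩
  have hU1 : ∀ τ t, V (t + 1) • δ τ t - ∑ s ∈ Finset.range (t + 1), q s • δ τ s = U τ t := by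
    intro τ t
    rw [hU, Finset.sum_range_succ, hq t, sub_smul]
    abel
  obtain ⟨a, ha⟩ : ∃ a : ℕ → ℝ, ∀ s, a s =
      ∑ τ : Fin k → Fin M, (1 / (M : ℝ)) * ∑ m, ‖mulVecE (X m) (δ τ s)‖ ^ 2 :=
    ⟨_, fun _ => rfl⟩
  have ha0 : ∀ s, 0 ≤ a s := by
    intro s
    rw [ha]
    positivity
  obtain ⟨c, hc⟩ : ∃ c : ℕ → ℝ, ∀ t, c t = η t * V (t + 1) ^ 2 / (1 + η t * R ^ 2) ^ 2 :=
    ⟨_, fun _ => rfl⟩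
  have hstep : ∀ t, t < k → ∑ τ, ‖U τ (t + 1)‖ ^ 2 ≤ ∑ τ, ‖U τ t‖ ^ 2 - c t * a t
      + η t * V (t + 1) * ∑ s ∈ Finset.range (t + 1), q s * a s := by
    intro t ht
    have hswap : ∀ s, s ≤ t →
        ∑ τ : Fin k → Fin M, ‖mulVecE (X (τ ⟨t, ht⟩)) (δ τ s)‖ ^ 2 = a s := by
      intro s hs
      rw [ha]
      apply sum_swap ⟨t, ht⟩ (fun τ m => ‖mulVecE (X m) (δ τ s)‖ ^ 2) hM
      intro τ m m'
      have : w (Function.update τ ⟨t, ht⟩ m') s = w τ s := by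
        apply hdep s (by omega)
        intro i hi
        apply Function.update_of_ne
        rintro rfl
        simp at hi
        omega
      simp only [hδ, this]
    have hone : ∀ τ : Fin k → Fin M, ‖U τ (t + 1)‖ ^ 2 ≤ ‖U τ t‖ ^ 2
        - c t * ‖mulVecE (X (τ ⟨t, ht⟩)) (δ τ t)‖ ^ 2
        + η t * V (t + 1) * ∑ s ∈ Finset.range (t + 1),
          q s * ‖mulVecE (X (τ ⟨t, ht⟩)) (δ τ s)‖ ^ 2 := by
      intro τ
      have hl := hlam ⟨t, ht⟩
      simp only at hl
      have hx := hx1 t ht.le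
      have hlη : (lam ⟨t, ht⟩)⁻¹ = η t := by
        rw [hl, hη, he]
        field_simp
      have hl0 : 0 < lam ⟨t, ht⟩ := by
        rw [← inv_pos, hlη]; exact hη0 t ht.le
      have h1 := step_exists (X (τ ⟨t, ht⟩)) (y (τ ⟨t, ht⟩)) wstar (w τ t) (hreal _)
        (lam ⟨t, ht⟩) hl0 (w τ (t + 1)) (hwt τ ⟨t, ht⟩)
      rw [hlη, ← hδ, ← hδ] at h1
      have h2 := step_ineq (X (τ ⟨t, ht⟩)) R hR (hX _) (η t) (V (t + 1)) (hη0 t ht.le).le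
        (hVpos (t + 1) (by omega)).le (δ τ (t + 1)) (t + 1) q (δ τ) (hqmem t ht.le)
        (hqsum t ht.le) (δ τ t) h1
      rw [hU1, ← hU, ← hc] at h2
      exact h2
    calc _ ≤ ∑ τ : Fin k → Fin M, (‖U τ t‖ ^ 2
        - c t * ‖mulVecE (X (τ ⟨t, ht⟩)) (δ τ t)‖ ^ 2
        + η t * V (t + 1) * ∑ s ∈ Finset.range (t + 1),
          q s * ‖mulVecE (X (τ ⟨t, ht⟩)) (δ τ s)‖ ^ 2) := Finset.sum_le_sum fun τ _ => hone τ
      _ = _ := by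
        rw [Finset.sum_add_distrib, Finset.sum_sub_distrib, ← Finset.mul_sum, ← Finset.mul_sum,
          hswap t le_rfl, Finset.sum_comm]
        congr 2
        apply Finset.sum_congr rfl
        intro s hs
        have := Finset.mem_range.1 hs
        rw [← Finset.mul_sum, hswap s (by omega)]
  have hlast : 0 ≤ ∑ τ, ‖U τ k‖ ^ 2 - c k * a k
      + η k * V (k + 1) * ∑ s ∈ Finset.range (k + 1), q s * a s := by
    have hone : ∀ (τ : Fin k → Fin M) (m : Fin M), 0 ≤ ‖U τ k‖ ^ 2
        - c k * ‖mulVecE (X m) (δ τ k)‖ ^ 2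
        + η k * V (k + 1) * ∑ s ∈ Finset.range (k + 1),
          q s * ‖mulVecE (X m) (δ τ s)‖ ^ 2 := by
      intro τ m
      have hη1 := hη0 k le_rfl
      have h1 := step_exists (X m) (y m) wstar (w τ k) (hreal _)
        (η k)⁻¹ (inv_pos.2 hη1) _ rfl
      rw [inv_inv, ← hδ] at h1
      have h2 := step_ineq (X m) R hR (hX _) (η k) (V (k + 1)) hη1.le
        (hVpos (k + 1) le_rfl).le _ (k + 1) q (δ τ) (hqmem k le_rfl)
        (hqsum k le_rfl) (δ τ k) h1
      rw [hU1, ← hc] at h2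
      exact le_trans (by positivity) h2
    have h3 : 0 ≤ ∑ τ : Fin k → Fin M, (1 / (M : ℝ)) * ∑ m, (‖U τ k‖ ^ 2
        - c k * ‖mulVecE (X m) (δ τ k)‖ ^ 2
        + η k * V (k + 1) * ∑ s ∈ Finset.range (k + 1),
          q s * ‖mulVecE (X m) (δ τ s)‖ ^ 2) := by
      apply Finset.sum_nonneg
      intro τ _
      apply mul_nonneg (by positivity)
      exact Finset.sum_nonneg fun m _ => hone τ m
    refine h3.trans_eq ?_
    have h4 : ∀ τ : Fin k → Fin M, (1 / (M : ℝ)) * ∑ m, (‖U τ k‖ ^ 2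
        - c k * ‖mulVecE (X m) (δ τ k)‖ ^ 2
        + η k * V (k + 1) * ∑ s ∈ Finset.range (k + 1),
          q s * ‖mulVecE (X m) (δ τ s)‖ ^ 2) =
        ‖U τ k‖ ^ 2 - c k * ((1 / (M : ℝ)) * ∑ m, ‖mulVecE (X m) (δ τ k)‖ ^ 2)
        + η k * V (k + 1) * ∑ s ∈ Finset.range (k + 1),
          q s * ((1 / (M : ℝ)) * ∑ m, ‖mulVecE (X m) (δ τ s)‖ ^ 2) := by
      intro τ
      rw [Finset.sum_add_distrib, Finset.sum_sub_distrib, ← Finset.mul_sum, ← Finset.mul_sum,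
        Finset.sum_comm, Finset.sum_const, Finset.card_univ, Fintype.card_fin, nsmul_eq_mul]
      simp only [← Finset.mul_sum]
      have h5 : ∑ s ∈ Finset.range (k + 1),
          q s * ((1 / (M : ℝ)) * ∑ m, ‖mulVecE (X m) (δ τ s)‖ ^ 2)
          = (1 / (M : ℝ)) * ∑ s ∈ Finset.range (k + 1),
            q s * ∑ m, ‖mulVecE (X m) (δ τ s)‖ ^ 2 := by
        rw [Finset.mul_sum]
        exact Finset.sum_congr rfl fun s _ => by ring
      rw [h5]
      field_simp
    rw [Finset.sum_congr rfl fun τ _ => h4 τ, Finset.sum_add_distrib, Finset.sum_sub_distrib,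
      ← Finset.mul_sum Finset.univ _ (c k), ← Finset.mul_sum Finset.univ _ (η k * V (k + 1)),
      ← ha, Finset.sum_comm]
    congr 2
    apply Finset.sum_congr rfl
    intro s _
    rw [← Finset.mul_sum Finset.univ _ (q s), ← ha]
  -- potential
  obtain ⟨S, hS⟩ : ∃ S : ℕ → ℝ, ∀ t, S t = e * (((k : ℝ) - t + 1)
      + ((k : ℝ) - t + 1) * (((k : ℝ) - t + 1) + 1) / (4 * ((k : ℝ) + 1))) := ⟨_, fun _ => rfl⟩
  have hSrec : ∀ t, t ≤ k → S t = S (t + 1) + η t * V (t + 1) := by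
    intro t ht
    have hx := hx1 t ht
    rw [hS, hS, hη, hV1]
    push_cast
    have e1 : (k : ℝ) - (t + 1) + 1 = ((k : ℝ) - t + 1) - 1 := by ring
    rw [e1]
    generalize (k : ℝ) - t + 1 = x at hx
    have : x ≠ 0 := by linarith
    field_simp
    ring
  have hcx : ∀ t, c t = e * ((k : ℝ) - t + 1) *
      (1 / ((k : ℝ) - t + 1) + 1 / (2 * ((k : ℝ) + 1))) ^ 2 /
        (1 + 3 * ((k : ℝ) - t + 1) / (13 * ((k : ℝ) + 1))) ^ 2 := by
    intro t
    have : η t * R ^ 2 = 3 * ((k : ℝ) - t + 1) / (13 * ((k : ℝ) + 1)) := by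
      rw [hη, mul_right_comm, heR]; ring
    rw [hc, this, hη, hV1]
  have hcS : ∀ t, t ≤ k → S t * q t ≤ c t := by
    intro t ht
    rw [hS, hqx, hcx]
    apply numeric_b _ _ _ (hx1 t ht) _ he0.le
    have : (0 : ℝ) ≤ t := by positivity
    linarith
  have hpot : ∀ t, t ≤ k → ∑ τ, ‖U τ t‖ ^ 2 + S t * ∑ s ∈ Finset.range t, q s * a s
      ≤ (M : ℝ) ^ k * (V 0 ^ 2 * ‖w0 - wstar‖ ^ 2) := by
    intro t
    induction t with
    | zero =>
      intro _
      simp only [hU, hδ, hw0]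
      simp [norm_smul, mul_pow]
    | succ t ih =>
      intro ht
      have h1 := ih (by omega)
      have h2 := hstep t (by omega)
      have h3 := hSrec t (by omega)
      have h4 := mul_le_mul_of_nonneg_right (hcS t (by omega)) (ha0 t)
      rw [h3] at h1 h4
      rw [Finset.sum_range_succ] at h2 ⊢
      nlinarith
  have hfin : (e * (5 / 12)) * a k ≤ (M : ℝ) ^ k * (V 0 ^ 2 * ‖w0 - wstar‖ ^ 2) := by
    have h1 := hpot k le_rfl
    have h3 := hSrec k le_rfl
    have hS1 : S (k + 1) = 0 := by rw [hS]; push_cast; ring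
    rw [hS1, zero_add] at h3
    rw [Finset.sum_range_succ, ← h3] at hlast
    have h5 : e * (5 / 12) ≤ c k - S k * q k := by
      rw [hcx, hS, hqx]
      have : (k : ℝ) - k + 1 = 1 := by ring
      rw [this]
      exact numeric_c _ _ hk3 he0.le
    have h6 := mul_le_mul_of_nonneg_right h5 (ha0 k)
    nlinarith
  have hV0 : V 0 ^ 2 ≤ 9 / (4 * ((k : ℝ) + 1) ^ 2) := by
    have h1 : V 0 ≤ 3 / (2 * ((k : ℝ) + 1)) := by
      rw [hV]
      have : 1 / ((k : ℝ) - (0 : ℕ) + 2) ≤ 1 / ((k : ℝ) + 1) :=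
        one_div_le_one_div_of_le (by positivity) (by push_cast; linarith)
      have e1 : 3 / (2 * ((k : ℝ) + 1)) = 1 / ((k : ℝ) + 1) + 1 / (2 * ((k : ℝ) + 1)) := by
        field_simp; norm_num
      rw [e1]
      linarith
    calc V 0 ^ 2 ≤ (3 / (2 * ((k : ℝ) + 1))) ^ 2 := by
          have := (hVpos 0 (by omega)).le
          gcongr
      _ = _ := by rw [div_pow]; norm_num [mul_pow]
  have hgoal : (∑ τ : Fin k → Fin M,
      (1 / (M : ℝ)) * ∑ m, (1 / 2) * ‖mulVecE (X m) (w τ k) - y m‖ ^ 2) = a k / 2 := by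
    rw [ha, Finset.sum_div]
    apply Finset.sum_congr rfl
    intro τ _
    rw [← Finset.mul_sum]
    simp only [hδ, mulVecE_sub', hreal]
    ring
  rw [hgoal, div_le_iff₀ (by positivity)]
  have hMk : (0 : ℝ) < (M : ℝ) ^ k := by positivity
  generalize hP : (M : ℝ) ^ k = P at *
  have h7 : e * (5 / 12) * a k ≤ P * (9 / (4 * ((k : ℝ) + 1) ^ 2) * ‖w0 - wstar‖ ^ 2) :=
    hfin.trans (by gcongr)
  have h8 : a k ≤ P * (9 / (4 * ((k : ℝ) + 1) ^ 2) * ‖w0 - wstar‖ ^ 2) / (e * (5 / 12)) := by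
    rw [le_div_iff₀ (by positivity)]; linarith
  have h9 : P * (9 / (4 * ((k : ℝ) + 1) ^ 2) * ‖w0 - wstar‖ ^ 2) / (e * (5 / 12))
      = (117 / 5) * (‖w0 - wstar‖ ^ 2 * R ^ 2 / ((k : ℝ) + 1) * P) := by
    rw [he]; field_simp; ring
  rw [h9] at h8
  have h10 : 0 ≤ ‖w0 - wstar‖ ^ 2 * R ^ 2 / ((k : ℝ) + 1) * P := by positivity
  have h11 : 20 * ‖w0 - wstar‖ ^ 2 * R ^ 2 / ((k : ℝ) + 1) * P
      = 20 * (‖w0 - wstar‖ ^ 2 * R ^ 2 / ((k : ℝ) + 1) * P) := by ring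
  rw [h11]
  linarith
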